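/- Drift-plus-penalty cost bound: suppose L(t) ≥ 0, L(1) = 0, and for each frame i, E[L(1+iT)] - E[L(1+(i-1)T)] + W·E[Γ(i)] ≤ T²·B + T·W·Γ* with Γ(i) ≥ 0, W > 0. Then limsup_{J→∞} (1/J)·Σ_{i=1}^{J} E[Γ(i)] ≤ T²·B/W + T·Γ*. -/

import Mathlib

open Filter

/-- Drift-plus-penalty cost bound (telescoping argument). -/
theorem stmt_10 (T : ℕ) (hT : 1 ≤ T) (B W Γstar : ℝ) (hW : 0 < W)
    (L Γ : ℕ → ℝ) (hL : ∀ t, 0 ≤ L t) (hL1 : L 1 = 0)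
    (hΓ : ∀ i, 0 ≤ Γ i)
    (hdrift : ∀ i : ℕ, L (1 + (i + 1) * T) - L (1 + i * T) + W * Γ (i + 1)
      ≤ (T : ℝ) ^ 2 * B + (T : ℝ) * W * Γstar) :
    Filter.limsup (fun J : ℕ => (1 / (J : ℝ)) * ∑ i ∈ Finset.range J, Γ (i + 1))
      Filter.atTop ≤ (T : ℝ) ^ 2 * B / W + (T : ℝ) * Γstar := by
  have key : ∀ J : ℕ, L (1 + J * T) + W * ∑ i ∈ Finset.range J, Γ (i + 1)
      ≤ (J : ℝ) * ((T : ℝ) ^ 2 * B + (T : ℝ) * W * Γstar) := by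
    intro J
    induction J with
    | zero => simp [hL1]
    | succ k ih =>
      rw [Finset.sum_range_succ]
      push_cast
      have h := hdrift k
      linarith
  refine Filter.limsup_le_of_le ?_ ?_
  · refine Filter.IsCoboundedUnder.of_frequently_ge (a := 0) (Filter.Frequently.of_forall ?_)
    intro J
    exact mul_nonneg (by positivity) (Finset.sum_nonneg fun i _ => hΓ _)
  · filter_upwards [Filter.eventually_gt_atTop 0] with J hJ
    have hJ' : (0 : ℝ) < J := by exact_mod_cast hJ
    have h := key J
    have h0 := hL (1 + J * T)
    have e : (T : ℝ) ^ 2 * B / W + (T : ℝ) * Γstar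
        = ((T : ℝ) ^ 2 * B + (T : ℝ) * W * Γstar) / W := by
      field_simp
    rw [e, one_div, inv_mul_eq_div, div_le_div_iff₀ hJ' hW]
    linarith
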